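/- Assume λ > cT(1+T). For every X in H and t in [0,T], the map K on C⁰([t,T];H) defined by K(Y)(s) = X − ((s−t)/λ) D F_T(Y(T)) − (1/λ) ∫_t^T D F(Y(σ)) (min(s,σ)−t) dσ is a contraction in the sup norm (with contraction constant cT(1+T)/λ < 1); consequently there is a unique Y(.) ∈ C⁰([t,T];H) with Y = K(Y), the pair (Y(s), Z(s)) with Z(s) = D F_T(Y(T)) + ∫_s^T D F(Y(σ)) dσ is the unique solution of the two-point boundary value problem dY/ds = −Z(s)/λ, −dZ/ds = D F(Y(s)), Y(t) = X, Z(T) = D F_T(Y(T)), and the unique optimal control for J_{X,t} is u(s) = −Z(s)/λ. -/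

import Mathlib

open MeasureTheory Set
open scoped RealInnerProductSpace

variable {H : Type*} [NormedAddCommGroup H] [InnerProductSpace ℝ H] [CompleteSpace H]

/-- The state `X(s) = X + ∫_t^s v(σ) dσ` associated to the control `v`. -/
noncomputable def state (X : H) (t : ℝ) (v : ℝ → H) (s : ℝ) : H :=
  X + ∫ σ in t..s, v σ

/-- A control belongs to `L²(t,T;H)`. -/
def Admissible (t T : ℝ) (v : ℝ → H) : Prop :=
  IntervalIntegrable v volume t T ∧ IntervalIntegrable (fun s => ‖v s‖ ^ 2) volume t T

/-- The cost functional `J_{X,t}(v)`. -/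
noncomputable def cost (F FT : H → ℝ) (lam : ℝ) (X : H) (t T : ℝ) (v : ℝ → H) : ℝ :=
  lam / 2 * (∫ s in t..T, ‖v s‖ ^ 2) + (∫ s in t..T, F (state X t v s)) + FT (state X t v T)

/-- The value function `V(X,t) = inf_v J_{X,t}(v)`. -/
noncomputable def valueFn (F FT : H → ℝ) (lam T : ℝ) (X : H) (t : ℝ) : ℝ :=
  sInf ((fun v => cost F FT lam X t T v) '' {v : ℝ → H | Admissible t T v})

/-- The adjoint state `Z(s) = D F_T(Y(T)) + ∫_s^T D F(Y(σ)) dσ` associated to a path `Y`. -/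
noncomputable def adjZ (DF DFT : H → H) (T : ℝ) (Y : ℝ → H) (s : ℝ) : H :=
  DFT (Y T) + ∫ σ in s..T, DF (Y σ)

/-- `Y` solves the two-point boundary value problem
`dY/ds = -(1/λ) Z(s)`, `-dZ/ds = D F(Y(s))`, `Y(t) = X`, `Z(T) = D F_T(Y(T))`,
where `Z = adjZ DF DFT T Y` encodes the two last conditions. -/
def IsOptimalPath (DF DFT : H → H) (lam T : ℝ) (X : H) (t : ℝ) (Y : ℝ → H) : Prop :=
  ContinuousOn Y (Icc t T) ∧ Y t = X ∧
    ∀ s ∈ Icc t T, HasDerivWithinAt Y (-(1 / lam) • adjZ DF DFT T Y s) (Icc t T) s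

/-- The fixed-point map `K(Y)(s) = X - ((s-t)/λ) • DF_T(Y(T)) - (1/λ) • ∫_t^T (min(s,σ)-t) • DF(Y(σ)) dσ`. -/
noncomputable def Kmap (DF DFT : H → H) (lam : ℝ) (X : H) (t T : ℝ) (Y : ℝ → H) (s : ℝ) : H :=
  X - ((s - t) / lam) • DFT (Y T) - (1 / lam) • ∫ σ in t..T, (min s σ - t) • DF (Y σ)

set_option linter.unusedSectionVars false

theorem exists_continuous_extension_Icc {a b : ℝ} (hab : a ≤ b) {f : ℝ → H}
    (hf : ContinuousOn f (Icc a b)) : ∃ g : ℝ → H, Continuous g ∧ ∀ x ∈ Icc a b, g x = f x :=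
  ⟨IccExtend hab ((Icc a b).domRestrict f), hf.domRestrict.Icc_extend',
    fun _ hx => IccExtend_of_mem hab _ hx⟩

theorem eqOn_Icc_of_hasDerivWithinAt_eq {a b : ℝ} {f g f' : ℝ → H}
    (hf : ∀ s ∈ Icc a b, HasDerivWithinAt f (f' s) (Icc a b) s)
    (hg : ∀ s ∈ Icc a b, HasDerivWithinAt g (f' s) (Icc a b) s)
    {x : ℝ} (hx : x ∈ Icc a b) (hfg : f x = g x) : ∀ s ∈ Icc a b, f s = g s := by
  intro s hs
  have h := Convex.norm_image_sub_le_of_norm_hasDerivWithin_le (f := f - g) (f' := fun _ => 0)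
    (s := Icc a b) (C := 0) (x := x) (y := s)
    (fun r hr => by simpa using (hf r hr).sub (hg r hr)) (by simp) (convex_Icc a b) hx hs
  simpa [hfg, sub_eq_zero] using h

theorem hasDerivWithinAt_adjZ {DF DFT : H → H} (hDF : Continuous DF) {t T : ℝ} (htT : t ≤ T)
    {Y : ℝ → H} (hY : ContinuousOn Y (Icc t T)) {s : ℝ} (hs : s ∈ Icc t T) :
    HasDerivWithinAt (adjZ DF DFT T Y) (-DF (Y s)) (Icc t T) s := by
  obtain ⟨y, hy, hyY⟩ := exists_continuous_extension_Icc htT hY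
  have hg : Continuous fun σ => DF (y σ) := hDF.comp hy
  have h : HasDerivAt (fun r => DFT (Y T) + ∫ σ in r..T, DF (y σ)) (-DF (y s)) s :=
    (intervalIntegral.integral_hasDerivAt_left (hg.intervalIntegrable _ _)
      (hg.stronglyMeasurableAtFilter _ _) hg.continuousAt).const_add _
  rw [hyY s hs] at h
  have key : ∀ r ∈ Icc t T, adjZ DF DFT T Y r = DFT (Y T) + ∫ σ in r..T, DF (y σ) := by
    intro r hr
    unfold adjZ
    congr 1
    refine intervalIntegral.integral_congr fun σ hσ => ?_
    rw [uIcc_of_le hr.2] at hσ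
    simp only [hyY σ ⟨hr.1.trans hσ.1, hσ.2⟩]
  exact h.hasDerivWithinAt.congr key (key s hs)

theorem integral_min_smul {g : ℝ → H} (hg : Continuous g) {t T s : ℝ} (hs : s ∈ Icc t T) :
    ∫ σ in t..T, (min s σ - t) • g σ =
      (∫ σ in t..s, (σ - t) • g σ) + (s - t) • ∫ σ in s..T, g σ := by
  have hc : Continuous fun σ => (min s σ - t) • g σ := by fun_prop
  rw [← intervalIntegral.integral_add_adjacent_intervals (hc.intervalIntegrable t s)
    (hc.intervalIntegrable s T), ← intervalIntegral.integral_smul]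
  congr 1
  · refine intervalIntegral.integral_congr fun σ hσ => ?_
    rw [uIcc_of_le hs.1] at hσ
    simp only [min_eq_right hσ.2]
  · refine intervalIntegral.integral_congr fun σ hσ => ?_
    rw [uIcc_of_le hs.2] at hσ
    simp only [min_eq_left hσ.1]

theorem hasDerivWithinAt_Kmap {DF DFT : H → H} (hDF : Continuous DF) (lam : ℝ) (X : H) {t T : ℝ}
    (htT : t ≤ T) {Y : ℝ → H} (hY : ContinuousOn Y (Icc t T)) {s : ℝ} (hs : s ∈ Icc t T) :
    HasDerivWithinAt (Kmap DF DFT lam X t T Y) (-(1 / lam) • adjZ DF DFT T Y s)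
      (Icc t T) s := by
  obtain ⟨y, hy, hyY⟩ := exists_continuous_extension_Icc htT hY
  have hg : Continuous fun σ => DF (y σ) := hDF.comp hy
  have hg' : Continuous fun σ => (σ - t) • DF (y σ) := by fun_prop
  have key : ∀ r ∈ Icc t T, Kmap DF DFT lam X t T Y r = X - ((r - t) / lam) • DFT (Y T) -
      (1 / lam) • ((∫ σ in t..r, (σ - t) • DF (y σ)) + (r - t) • ∫ σ in r..T, DF (y σ)) := by
    intro r hr
    rw [← integral_min_smul hg hr, Kmap]
    congr 2
    refine intervalIntegral.integral_congr fun σ hσ => ?_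
    rw [uIcc_of_le htT] at hσ
    simp only [hyY σ hσ]
  have h₁ := (hg'.integral_hasStrictDerivAt t s).hasDerivAt
  have h₂ : HasDerivAt (fun r => ∫ σ in r..T, DF (y σ)) (-DF (y s)) s :=
    intervalIntegral.integral_hasDerivAt_left (hg.intervalIntegrable _ _)
      (hg.stronglyMeasurableAtFilter _ _) hg.continuousAt
  have h₃ : HasDerivAt (fun r => r - t) 1 s := (hasDerivAt_id s).sub_const t
  have h := (((h₃.div_const lam).smul_const (DFT (Y T))).const_sub X).sub
    ((h₁.add (h₃.smul h₂)).const_smul (1 / lam))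
  have hZ : adjZ DF DFT T Y s = DFT (Y T) + ∫ σ in s..T, DF (y σ) := by
    unfold adjZ
    congr 1
    refine intervalIntegral.integral_congr fun σ hσ => ?_
    rw [uIcc_of_le hs.2] at hσ
    simp only [hyY σ ⟨hs.1.trans hσ.1, hσ.2⟩]
  refine (h.hasDerivWithinAt.congr_deriv ?_).congr key (key s hs)
  rw [hZ]
  module

theorem Kmap_left {DF DFT : H → H} (lam : ℝ) (X : H) {t T : ℝ} (htT : t ≤ T) (Y : ℝ → H) :
    Kmap DF DFT lam X t T Y t = X := by
  have h : ∫ σ in t..T, (min t σ - t) • DF (Y σ) = 0 := by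
    refine intervalIntegral.integral_zero_ae (.of_forall fun σ hσ => ?_)
    rw [uIoc_of_le htT] at hσ
    simp [min_eq_left hσ.1.le]
  simp [Kmap, h]

theorem norm_Kmap_sub_le {DF DFT : H → H} {c T lam t : ℝ} (hDFc : Continuous DF)
    (hDF : ∀ X₁ X₂ : H, ‖DF X₁ - DF X₂‖ ≤ c * ‖X₁ - X₂‖)
    (hDFT : ∀ X₁ X₂ : H, ‖DFT X₁ - DFT X₂‖ ≤ c * ‖X₁ - X₂‖)
    (hc : 0 ≤ c) (hlam : 0 < lam) (X : H) (ht : t ∈ Icc 0 T) {Y₁ Y₂ : ℝ → H}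
    (hY₁ : ContinuousOn Y₁ (Icc t T)) (hY₂ : ContinuousOn Y₂ (Icc t T)) {M : ℝ}
    (hM : ∀ σ ∈ Icc t T, ‖Y₁ σ - Y₂ σ‖ ≤ M) {s : ℝ} (hs : s ∈ Icc t T) :
    ‖Kmap DF DFT lam X t T Y₁ s - Kmap DF DFT lam X t T Y₂ s‖ ≤
      c * T * (1 + T) / lam * M := by
  obtain ⟨ht0, htT⟩ := ht
  have hTmem : T ∈ Icc t T := right_mem_Icc.2 htT
  have hM0 : 0 ≤ M := (norm_nonneg _).trans (hM s hs)
  have hT0 : 0 ≤ T := ht0.trans htT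
  have hint : ∀ Y : ℝ → H, ContinuousOn Y (Icc t T) →
      IntervalIntegrable (fun σ => (min s σ - t) • DF (Y σ)) volume t T := by
    intro Y hY
    refine ContinuousOn.intervalIntegrable_of_Icc htT ?_
    exact ContinuousOn.smul (by fun_prop) (hDFc.comp_continuousOn hY)
  have heq : Kmap DF DFT lam X t T Y₁ s - Kmap DF DFT lam X t T Y₂ s =
      -(((s - t) / lam) • (DFT (Y₁ T) - DFT (Y₂ T)) +
        (1 / lam) • ∫ σ in t..T, (min s σ - t) • (DF (Y₁ σ) - DF (Y₂ σ))) := by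
    simp only [smul_sub]
    rw [intervalIntegral.integral_sub (by simpa using hint Y₁ hY₁) (by simpa using hint Y₂ hY₂)]
    unfold Kmap
    module
  have h₁ : ‖((s - t) / lam) • (DFT (Y₁ T) - DFT (Y₂ T))‖ ≤ T / lam * (c * M) := by
    rw [norm_smul, Real.norm_of_nonneg (div_nonneg (sub_nonneg.2 hs.1) hlam.le)]
    gcongr
    · linarith [hs.2]
    · exact (hDFT _ _).trans (by gcongr; exact hM T hTmem)
  have h₂ : ‖∫ σ in t..T, (min s σ - t) • (DF (Y₁ σ) - DF (Y₂ σ))‖ ≤ T * (c * M) * T := by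
    refine (intervalIntegral.norm_integral_le_of_norm_le_const (C := T * (c * M)) ?_).trans ?_
    · intro σ hσ
      rw [uIoc_of_le htT] at hσ
      have hmin : 0 ≤ min s σ - t := sub_nonneg.2 (le_min hs.1 hσ.1.le)
      rw [norm_smul, Real.norm_of_nonneg hmin]
      gcongr
      · linarith [min_le_left s σ, hs.2]
      · exact (hDF _ _).trans (by gcongr; exact hM σ ⟨hσ.1.le, hσ.2⟩)
    · rw [abs_of_nonneg (sub_nonneg.2 htT)]
      gcongr
      linarith
  calc _ ≤ T / lam * (c * M) + 1 / lam * (T * (c * M) * T) := by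
        rw [heq, norm_neg]
        refine (norm_add_le _ _).trans (add_le_add h₁ ?_)
        rw [norm_smul, Real.norm_of_nonneg (by positivity)]
        gcongr
    _ = _ := by ring

theorem exists_fixedPoint_Kmap {DF DFT : H → H} {c T lam t : ℝ} (hDFc : Continuous DF)
    (hDF : ∀ X₁ X₂ : H, ‖DF X₁ - DF X₂‖ ≤ c * ‖X₁ - X₂‖)
    (hDFT : ∀ X₁ X₂ : H, ‖DFT X₁ - DFT X₂‖ ≤ c * ‖X₁ - X₂‖)
    (hc : 0 ≤ c) (hlam : 0 < lam) (hlc : c * T * (1 + T) / lam < 1)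
    (X : H) (ht : t ∈ Icc 0 T) :
    ∃ Y : ℝ → H, ContinuousOn Y (Icc t T) ∧ ∀ s ∈ Icc t T, Y s = Kmap DF DFT lam X t T Y s := by
  have htT : t ≤ T := ht.2
  have hT0 : 0 ≤ T := ht.1.trans ht.2
  let ext : C(Icc t T, H) → ℝ → H := fun y => IccExtend htT y
  have hext : ∀ y, ContinuousOn (ext y) (Icc t T) := fun y =>
    (map_continuous y).Icc_extend'.continuousOn
  let Φ : C(Icc t T, H) → C(Icc t T, H) := fun y =>
    ⟨(Icc t T).domRestrict (Kmap DF DFT lam X t T (ext y)), continuousOn_iff_continuous_domRestrict.1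
      fun s hs => (hasDerivWithinAt_Kmap hDFc lam X htT (hext y) hs).continuousWithinAt⟩
  have hΦ : ContractingWith ⟨c * T * (1 + T) / lam, by positivity⟩ Φ := by
    refine ⟨by exact_mod_cast hlc, LipschitzWith.of_dist_le_mul fun y₁ y₂ => ?_⟩
    refine (ContinuousMap.dist_le (mul_nonneg (NNReal.coe_nonneg _) dist_nonneg)).2 fun s => ?_
    rw [dist_eq_norm]
    refine norm_Kmap_sub_le hDFc hDF hDFT hc hlam X ht (hext y₁) (hext y₂) (fun σ hσ => ?_) s.2
    simp only [ext, IccExtend_of_mem htT _ hσ]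
    rw [← dist_eq_norm]
    exact ContinuousMap.dist_apply_le_dist _
  refine ⟨ext (hΦ.fixedPoint Φ), hext _, fun s hs => ?_⟩
  have h := congrArg (fun y : C(Icc t T, H) => y ⟨s, hs⟩) hΦ.fixedPoint_isFixedPt
  simp only [ext, IccExtend_of_mem htT _ hs]
  exact h.symm

theorem fixedPoint_Kmap_unique {DF DFT : H → H} {c T lam t : ℝ} (hDFc : Continuous DF)
    (hDF : ∀ X₁ X₂ : H, ‖DF X₁ - DF X₂‖ ≤ c * ‖X₁ - X₂‖)
    (hDFT : ∀ X₁ X₂ : H, ‖DFT X₁ - DFT X₂‖ ≤ c * ‖X₁ - X₂‖)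
    (hc : 0 ≤ c) (hlam : 0 < lam) (hlc : c * T * (1 + T) / lam < 1)
    (X : H) (ht : t ∈ Icc 0 T) {Y₁ Y₂ : ℝ → H}
    (hY₁ : ContinuousOn Y₁ (Icc t T)) (hY₂ : ContinuousOn Y₂ (Icc t T))
    (h₁ : ∀ s ∈ Icc t T, Y₁ s = Kmap DF DFT lam X t T Y₁ s)
    (h₂ : ∀ s ∈ Icc t T, Y₂ s = Kmap DF DFT lam X t T Y₂ s) :
    ∀ s ∈ Icc t T, Y₁ s = Y₂ s := by
  obtain ⟨r, hr, hmax⟩ := isCompact_Icc.exists_isMaxOn (nonempty_Icc.2 ht.2) (hY₁.sub hY₂).norm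
  have h := norm_Kmap_sub_le hDFc hDF hDFT hc hlam X ht hY₁ hY₂ (fun σ hσ => hmax hσ) hr
  rw [← h₁ r hr, ← h₂ r hr] at h
  intro s hs
  have hle : ‖Y₁ s - Y₂ s‖ ≤ ‖Y₁ r - Y₂ r‖ := hmax hs
  have h0 : ‖Y₁ s - Y₂ s‖ ≤ 0 := hle.trans (by
    simp only [Pi.sub_apply] at h
    nlinarith [norm_nonneg (Y₁ r - Y₂ r)])
  exact sub_eq_zero.1 (norm_le_zero_iff.1 h0)

theorem inner_sub_le_of_hasGradientAt {F : H → ℝ} {DF : H → H} {c : ℝ}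
    (hF : ∀ X, HasGradientAt F (DF X) X)
    (hDF : ∀ X₁ X₂ : H, ‖DF X₁ - DF X₂‖ ≤ c * ‖X₁ - X₂‖) (x d : H) :
    ⟪DF x, d⟫ - c / 2 * ‖d‖ ^ 2 ≤ F (x + d) - F x := by
  have hφ : ∀ τ : ℝ, HasDerivAt
      (fun τ : ℝ => F (x + τ • d) - τ * ⟪DF x, d⟫ + c / 2 * ‖d‖ ^ 2 * τ ^ 2)
      (⟪DF (x + τ • d), d⟫ - ⟪DF x, d⟫ + c * ‖d‖ ^ 2 * τ) τ := by
    intro τ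
    have h₁ : HasDerivAt (fun τ : ℝ => x + τ • d) d τ := by
      simpa using ((hasDerivAt_id τ).smul_const d).const_add x
    have h₂ : HasDerivAt (fun τ : ℝ => F (x + τ • d)) ⟪DF (x + τ • d), d⟫ τ := by
      exact (hF (x + τ • d)).hasFDerivAt.comp_hasDerivAt τ h₁
    have h₃ := (hasDerivAt_id τ).mul_const ⟪DF x, d⟫
    have h₄ := (hasDerivAt_pow 2 τ).const_mul (c / 2 * ‖d‖ ^ 2)
    refine ((h₂.sub h₃).add h₄).congr_deriv ?_
    norm_num
    ring
  have hmono := monotoneOn_of_deriv_nonneg (convex_Icc (0 : ℝ) 1)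
    (fun τ _ => (hφ τ).continuousAt.continuousWithinAt)
    (fun τ _ => (hφ τ).differentiableAt.differentiableWithinAt) (by
      intro τ hτ
      rw [interior_Icc] at hτ
      rw [(hφ τ).deriv, ← inner_sub_left]
      have hlip : ‖DF (x + τ • d) - DF x‖ ≤ c * (τ * ‖d‖) := by
        simpa [norm_smul, abs_of_pos hτ.1] using hDF (x + τ • d) x
      have hcs := neg_le_of_abs_le (abs_real_inner_le_norm (DF (x + τ • d) - DF x) d)
      nlinarith [mul_le_mul_of_nonneg_right hlip (norm_nonneg d)])
  have h := hmono (left_mem_Icc.2 zero_le_one) (right_mem_Icc.2 zero_le_one) zero_le_one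
  norm_num at h
  linarith

theorem integral_inner_integral_swap {t T : ℝ} (htT : t ≤ T) {g w : ℝ → H}
    (hg : IntervalIntegrable g volume t T) (hw : IntervalIntegrable w volume t T) :
    ∫ s in t..T, ⟪∫ σ in s..T, g σ, w s⟫ = ∫ σ in t..T, ⟪g σ, ∫ s in t..σ, w s⟫ := by
  rw [intervalIntegrable_iff_integrableOn_Ioc_of_le htT] at hg hw
  have hop : Continuous (Function.uncurry fun a b : H => ⟪a, b⟫) := by
    simpa [Function.uncurry_def] using continuous_inner (𝕜 := ℝ) (E := H)
  have hprod : Integrable (fun z : ℝ × ℝ => ⟪g z.2, w z.1⟫)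
      ((volume.restrict (Ioc t T)).prod (volume.restrict (Ioc t T))) := by
    have h := Integrable.op_fst_snd hop ⟨1, fun a b => by
      simpa using norm_inner_le_norm (𝕜 := ℝ) a b⟩ hg hw
    exact h.swap
  have hind : Integrable (Function.uncurry fun s σ : ℝ => if s ≤ σ then ⟪g σ, w s⟫ else 0)
      ((volume.restrict (Ioc t T)).prod (volume.restrict (Ioc t T))) := by
    have hS : MeasurableSet {z : ℝ × ℝ | z.1 ≤ z.2} := measurableSet_le measurable_fst measurable_snd
    exact hprod.indicator hS
  have hswap := integral_integral_swap hind
  rw [intervalIntegral.integral_of_le htT, intervalIntegral.integral_of_le htT]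
  convert hswap using 1
  · refine setIntegral_congr_fun measurableSet_Ioc fun s hs => ?_
    have hgs : IntegrableOn g (Ioc s T) := hg.mono_set (Ioc_subset_Ioc_left hs.1.le)
    rw [intervalIntegral.integral_of_le hs.2, real_inner_comm, ← integral_inner hgs,
      ← integral_Icc_eq_integral_Ioc]
    have hset : Icc s T = Ici s ∩ Ioc t T := by
      ext σ
      exact ⟨fun h => ⟨h.1, hs.1.trans_le h.1, h.2⟩, fun h => ⟨h.1, h.2.2⟩⟩
    rw [hset, ← Measure.restrict_restrict measurableSet_Ici, ← integral_indicator measurableSet_Ici]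
    refine integral_congr_ae (.of_forall fun σ => ?_)
    simp [indicator_apply, real_inner_comm]
  · refine setIntegral_congr_fun measurableSet_Ioc fun σ hσ => ?_
    have hws : IntegrableOn w (Ioc t σ) := hw.mono_set (Ioc_subset_Ioc_right hσ.2)
    rw [intervalIntegral.integral_of_le hσ.1.le, ← integral_inner hws]
    have hset : Ioc t σ = Iic σ ∩ Ioc t T := by
      ext s
      exact ⟨fun h => ⟨h.2, h.1, h.2.trans hσ.2⟩, fun h => ⟨h.2.1, h.1⟩⟩
    rw [hset, ← Measure.restrict_restrict measurableSet_Iic, ← integral_indicator measurableSet_Iic]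
    refine integral_congr_ae (.of_forall fun s => ?_)
    simp [indicator_apply]

theorem norm_integral_sq_le {t T s : ℝ} (hs : s ∈ Icc t T) {w : ℝ → H} (hw : Admissible t T w) :
    ‖∫ σ in t..s, w σ‖ ^ 2 ≤ (T - t) * ∫ σ in t..T, ‖w σ‖ ^ 2 := by
  have htT : t ≤ T := hs.1.trans hs.2
  set I := ∫ σ in t..T, ‖w σ‖ with hI
  set Q := ∫ σ in t..T, ‖w σ‖ ^ 2
  have hle : ‖∫ σ in t..s, w σ‖ ≤ I := by
    refine (intervalIntegral.norm_integral_le_integral_norm hs.1).trans ?_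
    exact intervalIntegral.integral_mono_interval le_rfl hs.1 hs.2
      (.of_forall fun _ => norm_nonneg _) hw.1.norm
  have hI0 : 0 ≤ I := (norm_nonneg _).trans hle
  have hquad : ∀ a : ℝ, 2 * a * I ≤ a ^ 2 * (T - t) + Q := by
    intro a
    have h : ∫ σ in t..T, 2 * a * ‖w σ‖ ≤ ∫ σ in t..T, (a ^ 2 + ‖w σ‖ ^ 2) :=
      intervalIntegral.integral_mono_on htT (hw.1.norm.const_mul _)
        (intervalIntegrable_const.add hw.2) fun σ _ => by nlinarith [sq_nonneg (a - ‖w σ‖)]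
    rw [intervalIntegral.integral_const_mul,
      intervalIntegral.integral_add intervalIntegrable_const hw.2] at h
    simp only [intervalIntegral.integral_const, smul_eq_mul] at h
    linarith
  rcases htT.eq_or_lt with rfl | hlt
  · have : s = t := le_antisymm hs.2 hs.1
    simp [this]
  · have hpos : 0 < T - t := sub_pos.2 hlt
    have h := hquad (I / (T - t))
    have h' : I ^ 2 ≤ (T - t) * Q := by
      field_simp at h
      nlinarith
    exact (pow_le_pow_left₀ (norm_nonneg _) hle 2).trans h'

theorem Admissible.add {t T : ℝ} {v w : ℝ → H} (hv : Admissible t T v)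
    (hw : Admissible t T w) : Admissible t T (fun s => v s + w s) := by
  refine ⟨hv.1.add hw.1, ((hv.2.add hw.2).const_mul 2).mono_fun
    ((intervalIntegrable_iff.1 (hv.1.add hw.1)).aestronglyMeasurable.norm.pow 2)
    (.of_forall fun s => ?_)⟩
  beta_reduce
  rw [Real.norm_of_nonneg (by positivity), Real.norm_of_nonneg (by positivity)]
  have h := norm_add_le (v s) (w s)
  have h' := pow_le_pow_left₀ (norm_nonneg _) h 2
  nlinarith [sq_nonneg (‖v s‖ - ‖w s‖)]

theorem Admissible.neg {t T : ℝ} {v : ℝ → H} (hv : Admissible t T v) :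
    Admissible t T (fun s => -v s) :=
  ⟨hv.1.neg, by simpa using hv.2⟩

theorem Admissible.intervalIntegrable_inner {t T : ℝ} {v w : ℝ → H}
    (hv : Admissible t T v) (hw : Admissible t T w) :
    IntervalIntegrable (fun s => ⟪v s, w s⟫) volume t T := by
  have h := (((hv.add hw).2.sub hv.2).sub hw.2).const_mul (1 / 2)
  refine h.congr (fun s _ => ?_)
  beta_reduce
  rw [norm_add_sq_real]
  ring

theorem continuousOn_state (X : H) {t T : ℝ} (htT : t ≤ T) {v : ℝ → H}
    (hv : IntervalIntegrable v volume t T) : ContinuousOn (state X t v) (Icc t T) := by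
  have h := intervalIntegral.continuousOn_primitive_interval' hv left_mem_uIcc
  rw [uIcc_of_le htT] at h
  exact continuousOn_const.add h

theorem state_eq_of_hasDerivWithinAt {X : H} {t T : ℝ} (htT : t ≤ T) {Y u : ℝ → H}
    (hu : ContinuousOn u (Icc t T)) (hY0 : Y t = X)
    (hY : ∀ s ∈ Icc t T, HasDerivWithinAt Y (u s) (Icc t T) s) :
    ∀ s ∈ Icc t T, state X t u s = Y s := by
  obtain ⟨g, hg, hgu⟩ := exists_continuous_extension_Icc htT hu
  have key : ∀ r ∈ Icc t T, state X t u r = X + ∫ σ in t..r, g σ := by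
    intro r hr
    unfold state
    congr 1
    refine intervalIntegral.integral_congr fun σ hσ => ?_
    rw [uIcc_of_le hr.1] at hσ
    exact (hgu σ ⟨hσ.1, hσ.2.trans hr.2⟩).symm
  refine eqOn_Icc_of_hasDerivWithinAt_eq (fun s hs => ?_) hY (left_mem_Icc.2 htT)
    (by simp [state, hY0])
  rw [← hgu s hs]
  exact (((hg.integral_hasStrictDerivAt t s).hasDerivAt.const_add X).hasDerivWithinAt).congr
    key (key s hs)

theorem admissible_of_continuousOn {t T : ℝ} (htT : t ≤ T) {u : ℝ → H}
    (hu : ContinuousOn u (Icc t T)) : Admissible t T u :=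
  ⟨hu.intervalIntegrable_of_Icc htT, (hu.norm.pow 2).intervalIntegrable_of_Icc htT⟩

theorem cost_add_integral_sq_le {F FT : H → ℝ} {DF DFT : H → H} {c T lam t : ℝ}
    (hF : ∀ X, HasGradientAt F (DF X) X) (hFT : ∀ X, HasGradientAt FT (DFT X) X)
    (hDFc : Continuous DF)
    (hDF : ∀ X₁ X₂ : H, ‖DF X₁ - DF X₂‖ ≤ c * ‖X₁ - X₂‖)
    (hDFT : ∀ X₁ X₂ : H, ‖DFT X₁ - DFT X₂‖ ≤ c * ‖X₁ - X₂‖)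
    (hc : 0 ≤ c) (hlam : 0 < lam) (X : H) (ht : t ∈ Icc 0 T) {Y u : ℝ → H}
    (hu : u = fun s => -(1 / lam) • adjZ DF DFT T Y s)
    (huc : ContinuousOn u (Icc t T)) (hYc : ContinuousOn Y (Icc t T)) (hY0 : Y t = X)
    (hY : ∀ s ∈ Icc t T, HasDerivWithinAt Y (u s) (Icc t T) s)
    {v : ℝ → H} (hv : Admissible t T v) :
    cost F FT lam X t T u + (lam - c * T * (1 + T)) / 2 * ∫ s in t..T, ‖v s - u s‖ ^ 2 ≤
      cost F FT lam X t T v := by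
  obtain ⟨ht0, htT⟩ := ht
  have hTmem : T ∈ Icc t T := right_mem_Icc.2 htT
  have hT0 : 0 ≤ T := ht0.trans htT
  have hu_adm := admissible_of_continuousOn htT huc
  set w : ℝ → H := fun s => v s - u s with hw_def
  have hw : Admissible t T w := by simpa [hw_def, sub_eq_add_neg] using hv.add hu_adm.neg
  have hvw : ∀ s, v s = u s + w s := fun s => by simp [hw_def]
  set Q := ∫ s in t..T, ‖w s‖ ^ 2
  have hQ0 : 0 ≤ Q := intervalIntegral.integral_nonneg htT fun _ _ => by positivity
  have hstate_u := state_eq_of_hasDerivWithinAt htT huc hY0 hY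
  have hstate_v : ∀ s ∈ Icc t T, state X t v s = Y s + ∫ σ in t..s, w σ := by
    intro s hs
    have hsub : uIcc t s ⊆ uIcc t T := by
      rw [uIcc_of_le hs.1, uIcc_of_le htT]
      exact Icc_subset_Icc_right hs.2
    rw [← hstate_u s hs, state, state, add_assoc, ← intervalIntegral.integral_add
      (hu_adm.1.mono_set hsub) (hw.1.mono_set hsub)]
    simp only [hvw]
  have hD : ∀ s ∈ Icc t T, ‖∫ σ in t..s, w σ‖ ^ 2 ≤ T * Q := fun s hs =>
    (norm_integral_sq_le hs hw).trans (by gcongr; linarith)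
  have hquad : ∫ s in t..T, ‖v s‖ ^ 2 =
      (∫ s in t..T, ‖u s‖ ^ 2) + 2 * (∫ s in t..T, ⟪u s, w s⟫) + Q := by
    rw [← intervalIntegral.integral_const_mul, ← intervalIntegral.integral_add hu_adm.2
      ((hu_adm.intervalIntegrable_inner hw).const_mul 2), ← intervalIntegral.integral_add
      (hu_adm.2.add ((hu_adm.intervalIntegrable_inner hw).const_mul 2)) hw.2]
    simp only [hvw, norm_add_sq_real]
  have hFc : Continuous F :=
    continuous_iff_continuousAt.2 fun x => (hF x).hasFDerivAt.continuousAt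
  have hDc : ContinuousOn (fun s => ∫ σ in t..s, w σ) (Icc t T) := by
    simpa [uIcc_of_le htT] using
      intervalIntegral.continuousOn_primitive_interval' hw.1 left_mem_uIcc
  have hg : ContinuousOn (fun s => DF (Y s)) (Icc t T) := hDFc.comp_continuousOn hYc
  have hgi : IntervalIntegrable (fun s => DF (Y s)) volume t T := hg.intervalIntegrable_of_Icc htT
  have hFY : IntervalIntegrable (fun s => F (Y s)) volume t T :=
    (hFc.comp_continuousOn hYc).intervalIntegrable_of_Icc htT
  have hinner : IntervalIntegrable (fun s => ⟪DF (Y s), ∫ σ in t..s, w σ⟫) volume t T :=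
    (hg.inner hDc).intervalIntegrable_of_Icc htT
  have hrun : (∫ s in t..T, F (Y s)) + (∫ s in t..T, ⟪DF (Y s), ∫ σ in t..s, w σ⟫) -
      T * (c / 2 * (T * Q)) ≤ ∫ s in t..T, F (state X t v s) := by
    have h := intervalIntegral.integral_mono_on htT
      ((hFY.add hinner).sub (intervalIntegrable_const (c := c / 2 * (T * Q))))
      ((hFc.comp_continuousOn (continuousOn_state X htT hv.1)).intervalIntegrable_of_Icc htT)
      (fun s hs => by
        have h₁ := inner_sub_le_of_hasGradientAt hF hDF (Y s) (∫ σ in t..s, w σ)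
        rw [← hstate_v s hs] at h₁
        have h₂ := mul_le_mul_of_nonneg_left (hD s hs) (by positivity : 0 ≤ c / 2)
        simp only [Function.comp_apply]
        linarith)
    rw [intervalIntegral.integral_sub (hFY.add hinner) intervalIntegrable_const,
      intervalIntegral.integral_add hFY hinner, intervalIntegral.integral_const, smul_eq_mul] at h
    have h' : (T - t) * (c / 2 * (T * Q)) ≤ T * (c / 2 * (T * Q)) := by
      gcongr
      linarith
    simp only [Function.comp_apply] at h
    linarith
  have hterm : FT (Y T) + ⟪DFT (Y T), ∫ σ in t..T, w σ⟫ - c / 2 * (T * Q) ≤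
      FT (state X t v T) := by
    have h₁ := inner_sub_le_of_hasGradientAt hFT hDFT (Y T) (∫ σ in t..T, w σ)
    rw [← hstate_v T hTmem] at h₁
    have h₂ := mul_le_mul_of_nonneg_left (hD T hTmem) (by positivity : 0 ≤ c / 2)
    linarith
  have hcross : lam * (∫ s in t..T, ⟪u s, w s⟫) = -(⟪DFT (Y T), ∫ σ in t..T, w σ⟫ +
      ∫ s in t..T, ⟪DF (Y s), ∫ σ in t..s, w σ⟫) := by
    have hconst : IntervalIntegrable (fun s => ⟪DFT (Y T), w s⟫) volume t T :=
      (admissible_of_continuousOn htT continuousOn_const).intervalIntegrable_inner hw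
    have hZw : ∀ s, lam * ⟪u s, w s⟫ =
        -(⟪DFT (Y T), w s⟫ + ⟪∫ σ in s..T, DF (Y σ), w s⟫) := by
      intro s
      rw [hu]
      simp only [adjZ, neg_smul, inner_neg_left, real_inner_smul_left, inner_add_left]
      field_simp
    have hint : IntervalIntegrable (fun s => ⟪∫ σ in s..T, DF (Y σ), w s⟫) volume t T := by
      have h := ((hu_adm.intervalIntegrable_inner hw).const_mul lam).neg.sub hconst
      refine h.congr fun s _ => ?_
      have := hZw s
      simp only [Pi.neg_apply]
      linarith
    rw [← intervalIntegral.integral_const_mul]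
    simp only [hZw]
    rw [intervalIntegral.integral_neg, intervalIntegral.integral_add hconst hint,
      integral_inner_integral_swap htT hgi hw.1]
    congr 2
    rw [intervalIntegral.integral_of_le htT, intervalIntegral.integral_of_le htT]
    exact integral_inner ((intervalIntegrable_iff_integrableOn_Ioc_of_le htT).1 hw.1) _
  have hcost_u : ∫ s in t..T, F (state X t u s) = ∫ s in t..T, F (Y s) := by
    refine intervalIntegral.integral_congr fun s hs => ?_
    rw [uIcc_of_le htT] at hs
    simp only [hstate_u s hs]
  unfold cost
  rw [hcost_u, hstate_u T hTmem, hquad]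
  linear_combination hrun + hterm - hcross

/-- `K` is a contraction on `C⁰([t,T];H)` with constant `cT(1+T)/λ < 1`; it has a
unique fixed point `Y`; the pair `(Y, Z)` with `Z = adjZ DF DFT T Y` solves the two-point
boundary value problem and is its unique solution; and `u = -(1/λ) Z` is the unique optimal
control for `J_{X,t}`. -/
theorem statement4
    (F FT : H → ℝ) (DF DFT : H → H) (c T lam : ℝ)
    (hF : ∀ X, HasGradientAt F (DF X) X) (hFT : ∀ X, HasGradientAt FT (DFT X) X)
    (hDF : ∀ X₁ X₂ : H, ‖DF X₁ - DF X₂‖ ≤ c * ‖X₁ - X₂‖)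
    (hDFT : ∀ X₁ X₂ : H, ‖DFT X₁ - DFT X₂‖ ≤ c * ‖X₁ - X₂‖)
    (hDF0 : ‖DF 0‖ ≤ c) (hDFT0 : ‖DFT 0‖ ≤ c)
    (hT : 0 < T) (hlam : 0 < lam)
    (hlc : c * T * (1 + T) < lam)
    (X : H) (t : ℝ) (ht : t ∈ Icc 0 T) :
    c * T * (1 + T) / lam < 1 ∧
    (∀ Y₁ Y₂ : ℝ → H, ContinuousOn Y₁ (Icc t T) → ContinuousOn Y₂ (Icc t T) →
      ∀ M : ℝ, (∀ σ ∈ Icc t T, ‖Y₁ σ - Y₂ σ‖ ≤ M) →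
        ∀ s ∈ Icc t T, ‖Kmap DF DFT lam X t T Y₁ s - Kmap DF DFT lam X t T Y₂ s‖ ≤
          c * T * (1 + T) / lam * M) ∧
    ∃ Y : ℝ → H, ContinuousOn Y (Icc t T) ∧
      (∀ s ∈ Icc t T, Y s = Kmap DF DFT lam X t T Y s) ∧
      (∀ Y' : ℝ → H, ContinuousOn Y' (Icc t T) →
        (∀ s ∈ Icc t T, Y' s = Kmap DF DFT lam X t T Y' s) → ∀ s ∈ Icc t T, Y' s = Y s) ∧
      Y t = X ∧
      (∀ s ∈ Icc t T, HasDerivWithinAt Y (-(1 / lam) • adjZ DF DFT T Y s) (Icc t T) s) ∧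
      (∀ s ∈ Icc t T, HasDerivWithinAt (adjZ DF DFT T Y) (-DF (Y s)) (Icc t T) s) ∧
      (∀ Y' Z' : ℝ → H, ContinuousOn Y' (Icc t T) → ContinuousOn Z' (Icc t T) →
        Y' t = X → Z' T = DFT (Y' T) →
        (∀ s ∈ Icc t T, HasDerivWithinAt Y' (-(1 / lam) • Z' s) (Icc t T) s) →
        (∀ s ∈ Icc t T, HasDerivWithinAt Z' (-DF (Y' s)) (Icc t T) s) →
        ∀ s ∈ Icc t T, Y' s = Y s ∧ Z' s = adjZ DF DFT T Y s) ∧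
      Admissible t T (fun s => -(1 / lam) • adjZ DF DFT T Y s) ∧
      (∀ v : ℝ → H, Admissible t T v →
        cost F FT lam X t T (fun s => -(1 / lam) • adjZ DF DFT T Y s) ≤
          cost F FT lam X t T v) ∧
      (∀ v : ℝ → H, Admissible t T v →
        (∀ w : ℝ → H, Admissible t T w → cost F FT lam X t T v ≤ cost F FT lam X t T w) →
        ∀ᵐ s ∂volume.restrict (Ioc t T), v s = -(1 / lam) • adjZ DF DFT T Y s) := by
  have hc : 0 ≤ c := (norm_nonneg _).trans hDF0
  have htT : t ≤ T := ht.2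
  have hlc' : c * T * (1 + T) / lam < 1 := (div_lt_one hlam).2 hlc
  have hDFc : Continuous DF := (LipschitzWith.of_dist_le_mul (K := ⟨c, hc⟩) fun x y => by
    rw [dist_eq_norm, dist_eq_norm]
    exact hDF x y).continuous
  refine ⟨hlc', fun Y₁ Y₂ hY₁ hY₂ M hM s hs =>
    norm_Kmap_sub_le hDFc hDF hDFT hc hlam X ht hY₁ hY₂ hM hs, ?_⟩
  obtain ⟨Y, hYc, hYfix⟩ := exists_fixedPoint_Kmap hDFc hDF hDFT hc hlam hlc' X ht
  have hYt : Y t = X := by rw [hYfix t (left_mem_Icc.2 htT), Kmap_left lam X htT]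
  have hY : ∀ s ∈ Icc t T, HasDerivWithinAt Y (-(1 / lam) • adjZ DF DFT T Y s) (Icc t T) s :=
    fun s hs => (hasDerivWithinAt_Kmap hDFc lam X htT hYc hs).congr hYfix (hYfix s hs)
  have hZ : ∀ s ∈ Icc t T, HasDerivWithinAt (adjZ DF DFT T Y) (-DF (Y s)) (Icc t T) s :=
    fun s hs => hasDerivWithinAt_adjZ hDFc htT hYc hs
  have huc : ContinuousOn (fun s => -(1 / lam) • adjZ DF DFT T Y s) (Icc t T) :=
    ContinuousOn.const_smul (fun s hs => (hZ s hs).continuousWithinAt) _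
  have hu_adm := admissible_of_continuousOn htT huc
  have hgap := fun v (hv : Admissible t T v) =>
    cost_add_integral_sq_le hF hFT hDFc hDF hDFT hc hlam X ht rfl huc hYc hYt hY hv
  have huniq : ∀ Y' : ℝ → H, ContinuousOn Y' (Icc t T) →
      (∀ s ∈ Icc t T, Y' s = Kmap DF DFT lam X t T Y' s) → ∀ s ∈ Icc t T, Y' s = Y s :=
    fun Y' hY' h => fixedPoint_Kmap_unique hDFc hDF hDFT hc hlam hlc' X ht hY' hYc h hYfix
  refine ⟨Y, hYc, hYfix, huniq, hYt, hY, hZ, ?_, hu_adm, ?_, ?_⟩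
  · intro Y' Z' hY'c hZ'c hY't hZ'T hY' hZ'
    have hZeq : ∀ s ∈ Icc t T, Z' s = adjZ DF DFT T Y' s :=
      eqOn_Icc_of_hasDerivWithinAt_eq hZ' (fun s hs => hasDerivWithinAt_adjZ hDFc htT hY'c hs)
        (right_mem_Icc.2 htT) (by simp [adjZ, hZ'T])
    have hYeq : ∀ s ∈ Icc t T, Y' s = Y s := by
      refine huniq Y' hY'c (eqOn_Icc_of_hasDerivWithinAt_eq (fun s hs => ?_)
        (fun s hs => hasDerivWithinAt_Kmap hDFc lam X htT hY'c hs) (left_mem_Icc.2 htT)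
        (by rw [hY't, Kmap_left lam X htT]))
      rw [← hZeq s hs]
      exact hY' s hs
    refine fun s hs => ⟨hYeq s hs, eqOn_Icc_of_hasDerivWithinAt_eq hZ' (fun r hr => ?_)
      (right_mem_Icc.2 htT) ?_ s hs⟩
    · rw [hYeq r hr]
      exact hZ r hr
    · simp [adjZ, hZ'T, hYeq T (right_mem_Icc.2 htT)]
  · intro v hv
    have hQ0 : 0 ≤ ∫ s in t..T, ‖v s - -(1 / lam) • adjZ DF DFT T Y s‖ ^ 2 :=
      intervalIntegral.integral_nonneg htT fun _ _ => by positivity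
    nlinarith [hgap v hv]
  · intro v hv hopt
    have hint : IntervalIntegrable (fun s => ‖v s - -(1 / lam) • adjZ DF DFT T Y s‖ ^ 2)
        volume t T := by
      simpa only [sub_eq_add_neg] using (hv.add hu_adm.neg).2
    have hQ0 : 0 ≤ ∫ s in t..T, ‖v s - -(1 / lam) • adjZ DF DFT T Y s‖ ^ 2 :=
      intervalIntegral.integral_nonneg htT fun _ _ => by positivity
    have hQ : ∫ s in t..T, ‖v s - -(1 / lam) • adjZ DF DFT T Y s‖ ^ 2 = 0 := by
      nlinarith [hgap v hv, hopt _ hu_adm]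
    rw [intervalIntegral.integral_of_le htT, integral_eq_zero_iff_of_nonneg_ae
      (.of_forall fun _ => by positivity)
      ((intervalIntegrable_iff_integrableOn_Ioc_of_le htT).1 hint)] at hQ
    filter_upwards [hQ] with s hs
    exact sub_eq_zero.1 (by simpa only [Pi.zero_apply, sq_eq_zero_iff, norm_eq_zero] using hs)
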